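/- arXiv:2512.07175 — 6 statements merged into one kernel-verified Lean document; each statement's English description precedes it below -/
import Mathlib

section
/- For all real numbers a > 0, b > 0 and s > 0, one has a·log(s/(s+b)) + b·log(b/(s+b)) ≤ a·log(a/(a+b)) + b·log(b/(a+b)), with equality if and only if s = a. -/
theorem log_sub_log_le_div_sub_one {x y : ℝ} (hx : 0 < x) (hy : 0 < y) :
    Real.log x - Real.log y ≤ x / y - 1 := by
  rw [← Real.log_div hx.ne' hy.ne']
  exact Real.log_le_sub_one_of_pos (div_pos hx hy)

theorem log_sub_log_lt_div_sub_one {x y : ℝ} (hx : 0 < x) (hy : 0 < y) (hxy : x ≠ y) :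
    Real.log x - Real.log y < x / y - 1 := by
  rw [← Real.log_div hx.ne' hy.ne']
  exact Real.log_lt_sub_one_of_pos (div_pos hx hy) (div_ne_one_of_ne hxy)

/-- Pointwise Gibbs-type inequality underlying Theorem 2: for `a, b, s > 0`,
`a·log(s/(s+b)) + b·log(b/(s+b)) ≤ a·log(a/(a+b)) + b·log(b/(a+b))`,
with equality if and only if `s = a`. -/
theorem gibbs_pointwise (a b s : ℝ) (ha : 0 < a) (hb : 0 < b) (hs : 0 < s) :
    a * Real.log (s / (s + b)) + b * Real.log (b / (s + b))
        ≤ a * Real.log (a / (a + b)) + b * Real.log (b / (a + b))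
    ∧ (a * Real.log (s / (s + b)) + b * Real.log (b / (s + b))
        = a * Real.log (a / (a + b)) + b * Real.log (b / (a + b)) ↔ s = a) := by
  have h_lt (hne : s ≠ a) :
      a * Real.log (s / (s + b)) + b * Real.log (b / (s + b))
        < a * Real.log (a / (a + b)) + b * Real.log (b / (a + b)) := by
    have hx : s / (s + b) ≠ a / (a + b) := by
      intro h
      rw [div_eq_div_iff (by positivity) (by positivity)] at h
      exact hne (mul_right_cancel₀ hb.ne' (by linarith))
    have h₁ := log_sub_log_lt_div_sub_one (by positivity) (by positivity) hx
    have h₂ := log_sub_log_le_div_sub_one (x := b / (s + b)) (y := b / (a + b))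
      (by positivity) (by positivity)
    have h_sum : a * (s / (s + b) / (a / (a + b)) - 1)
        + b * (b / (s + b) / (b / (a + b)) - 1) = 0 := by
      field_simp
      ring
    linarith [mul_lt_mul_of_pos_left h₁ ha, mul_le_mul_of_nonneg_left h₂ hb.le]
  rcases eq_or_ne s a with rfl | hne
  · simp
  · exact ⟨(h_lt hne).le, fun h => absurd h (h_lt hne).ne, fun h => absurd h hne⟩
end

section
/- Let α be a countable type, let μ > 0, and let p_data, p_t, p : α → ℝ be probability mass functions that are strictly positive at every point (each nonnegative with total sum 1). Define the SPACE loss L(p) = −∑_y [ p_data(y)·log( p(y) / (p(y) + μ·p_t(y)) ) + μ·p_t(y)·log( μ·p_t(y) / (p(y) + μ·p_t(y)) ) ], assuming the series defining L(p) and L(p_data) are summable. Then L(p) ≥ L(p_data), and L(p) = L(p_data) if and only if p = p_data. In particular, the real-data distribution p_data is the unique minimizer of the SPACE objective (achievability, Theorem 2). -/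
/-- The discrete (single-prompt) SPACE loss of equation (9). -/
noncomputable def spaceLoss {α : Type*} (μ : ℝ) (pt pdata q : α → ℝ) : ℝ :=
  -∑' y, (pdata y * Real.log (q y / (q y + μ * pt y))
          + μ * pt y * Real.log (μ * pt y / (q y + μ * pt y)))

/-- The weighted log-likelihood of a two-point classifier is uniquely maximized at the weights. -/
lemma mul_log_add_mul_log_lt {a b x : ℝ} (ha : 0 < a) (hb : 0 < b) (hx : 0 < x) (hne : x ≠ a) :
    a * Real.log (x / (x + b)) + b * Real.log (b / (x + b)) <
      a * Real.log (a / (a + b)) + b * Real.log (b / (a + b)) := by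
  have hab : 0 < a + b := by positivity
  have hxb : 0 < x + b := by positivity
  have h₁ : Real.log (x / (x + b)) - Real.log (a / (a + b)) ≤
      x / (x + b) / (a / (a + b)) - 1 := by
    rw [← Real.log_div (by positivity) (by positivity)]
    exact Real.log_le_sub_one_of_pos (by positivity)
  have h₂ : Real.log (b / (x + b)) - Real.log (b / (a + b)) <
      b / (x + b) / (b / (a + b)) - 1 := by
    rw [← Real.log_div (by positivity) (by positivity)]
    refine Real.log_lt_sub_one_of_pos (by positivity) fun h => hne ?_
    field_simp at h
    linarith
  have h₃ : a * (x / (x + b) / (a / (a + b)) - 1) +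
      b * (b / (x + b) / (b / (a + b)) - 1) = 0 := by
    field_simp
    ring
  have h₄ := mul_le_mul_of_nonneg_left h₁ ha.le
  have h₅ := mul_lt_mul_of_pos_left h₂ hb
  linarith

/-- Theorem 2 (achievability): the real-data distribution `pdata` is the unique
minimizer of the SPACE objective. -/
theorem space_achievability {α : Type*} [Countable α] (μ : ℝ) (hμ : 0 < μ)
    (pdata pt p : α → ℝ)
    (hd_pos : ∀ y, 0 < pdata y) (ht_pos : ∀ y, 0 < pt y) (hp_pos : ∀ y, 0 < p y)
    (hd_sum : ∑' y, pdata y = 1) (ht_sum : ∑' y, pt y = 1) (hp_sum : ∑' y, p y = 1)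
    (hsum_p : Summable fun y => pdata y * Real.log (p y / (p y + μ * pt y))
          + μ * pt y * Real.log (μ * pt y / (p y + μ * pt y)))
    (hsum_d : Summable fun y => pdata y * Real.log (pdata y / (pdata y + μ * pt y))
          + μ * pt y * Real.log (μ * pt y / (pdata y + μ * pt y))) :
    spaceLoss μ pt pdata p ≥ spaceLoss μ pt pdata pdata
    ∧ (spaceLoss μ pt pdata p = spaceLoss μ pt pdata pdata ↔ p = pdata) := by
  have hlt : ∀ y, p y ≠ pdata y → _ := fun y =>
    mul_log_add_mul_log_lt (hd_pos y) (mul_pos hμ (ht_pos y)) (hp_pos y)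
  have hle : ∀ y, pdata y * Real.log (p y / (p y + μ * pt y))
        + μ * pt y * Real.log (μ * pt y / (p y + μ * pt y)) ≤
      pdata y * Real.log (pdata y / (pdata y + μ * pt y))
        + μ * pt y * Real.log (μ * pt y / (pdata y + μ * pt y)) := fun y => by
    by_cases h : p y = pdata y
    · rw [h]
    · exact (hlt y h).le
  refine ⟨neg_le_neg (hsum_p.tsum_le_tsum hle hsum_d), fun h => ?_, fun h => by rw [h]⟩
  by_contra hne
  obtain ⟨y, hy⟩ := Function.ne_iff.mp hne
  exact (hsum_p.tsum_lt_tsum hle (hlt y hy) hsum_d).ne (neg_injective h)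
end

section
/- Fix real numbers a > 0 and μ > 0, and define h : (0, ∞) → ℝ by h(s) = log( s / (s + μ·a) ) + μ·log( a / (a + μ⁻¹·s) ). Then h is strictly increasing on (0, a) and strictly decreasing on (a, ∞); consequently h attains a strict global maximum on (0, ∞) uniquely at s = a, i.e., h(s) < h(a) for every s > 0 with s ≠ a, and s = a is the unique critical point of h on (0, ∞). -/
/-- The per-response SPACE log-likelihood term in the self-consistent regime
where the opponent distribution equals the real-data distribution. -/
noncomputable def hSpace (a μ : ℝ) : ℝ → ℝ :=
  fun s => Real.log (s / (s + μ * a)) + μ * Real.log (a / (a + μ⁻¹ * s))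

theorem hasDerivAt_hSpace {a μ s : ℝ} (ha : 0 < a) (hμ : 0 < μ) (hs : 0 < s) :
    HasDerivAt (hSpace a μ) (μ * (a - s) / (s * (s + μ * a))) s := by
  have h₁ : s + μ * a ≠ 0 := by positivity
  have h₂ : a + μ⁻¹ * s ≠ 0 := by positivity
  have h₃ : μ * a + s ≠ 0 := by positivity
  have hf := ((hasDerivAt_id' s).div ((hasDerivAt_id' s).add_const (μ * a)) h₁).log
    (div_ne_zero hs.ne' h₁)
  have hg := (((hasDerivAt_const s a).div
    (((hasDerivAt_id' s).const_mul μ⁻¹).const_add a) h₂).log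
    (div_ne_zero ha.ne' h₂)).const_mul μ
  refine (hf.add hg).congr_deriv ?_
  simp only [Pi.div_apply]
  field_simp
  ring

theorem hSpace_strictMonoOn {a μ : ℝ} (ha : 0 < a) (hμ : 0 < μ) :
    StrictMonoOn (hSpace a μ) (Set.Ioc 0 a) := by
  refine strictMonoOn_of_deriv_pos (convex_Ioc 0 a)
    (fun s hs => (hasDerivAt_hSpace ha hμ hs.1).continuousAt.continuousWithinAt) fun s hs => ?_
  rw [interior_Ioc] at hs
  have h₀ : 0 < s := hs.1
  have h₁ : 0 < a - s := sub_pos.2 hs.2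
  rw [(hasDerivAt_hSpace ha hμ h₀).deriv]
  positivity

theorem hSpace_strictAntiOn {a μ : ℝ} (ha : 0 < a) (hμ : 0 < μ) :
    StrictAntiOn (hSpace a μ) (Set.Ici a) := by
  refine strictAntiOn_of_deriv_neg (convex_Ici a)
    (fun s hs =>
      (hasDerivAt_hSpace ha hμ (ha.trans_le hs)).continuousAt.continuousWithinAt) fun s hs => ?_
  rw [interior_Ici] at hs
  have h₀ : 0 < s := ha.trans hs
  rw [(hasDerivAt_hSpace ha hμ h₀).deriv]
  exact div_neg_of_neg_of_pos (mul_neg_of_pos_of_neg hμ (sub_neg.2 hs)) (by positivity)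

/-- Theorem 3 (stable convergence), pointwise form: `h` is strictly increasing
on `(0, a)`, strictly decreasing on `(a, ∞)`, attains a strict global maximum
on `(0, ∞)` uniquely at `s = a`, and `s = a` is the unique critical point of
`h` on `(0, ∞)`. -/
theorem hSpace_max_at_a (a μ : ℝ) (ha : 0 < a) (hμ : 0 < μ) :
    StrictMonoOn (hSpace a μ) (Set.Ioo 0 a)
    ∧ StrictAntiOn (hSpace a μ) (Set.Ioi a)
    ∧ (∀ s : ℝ, 0 < s → s ≠ a → hSpace a μ s < hSpace a μ a)
    ∧ (∀ s : ℝ, 0 < s → (deriv (hSpace a μ) s = 0 ↔ s = a)) := by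
  refine ⟨(hSpace_strictMonoOn ha hμ).mono Set.Ioo_subset_Ioc_self,
    (hSpace_strictAntiOn ha hμ).mono Set.Ioi_subset_Ici_self, fun s hs hsa => ?_, fun s hs => ?_⟩
  · rcases lt_or_gt_of_ne hsa with h | h
    · exact hSpace_strictMonoOn ha hμ ⟨hs, h.le⟩ ⟨ha, le_rfl⟩ h
    · exact hSpace_strictAntiOn ha hμ Set.self_mem_Ici h.le h
  · have h : s * (s + μ * a) ≠ 0 := by positivity
    rw [(hasDerivAt_hSpace ha hμ hs).deriv, div_eq_zero_iff, or_iff_left h, mul_eq_zero,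
      or_iff_right hμ.ne', sub_eq_zero, eq_comm]
end

section
/- Let α be a countable type, let μ > 0, and let p_data : α → ℝ be a probability mass function that is strictly positive at every point. For any strictly positive probability mass function p : α → ℝ, define M(p) = −∑_y p_data(y)·[ log( p(y) / (p(y) + μ·p_data(y)) ) + μ·log( p_data(y) / (p_data(y) + μ⁻¹·p(y)) ) ], assuming the series defining M(p) and M(p_data) are summable. Then M(p) ≥ M(p_data), with equality if and only if p = p_data. In particular, if the opponent distribution at iteration t already equals p_data, then p_data remains the unique minimizer of the SPACE objective at iteration t+1 (maintainability, Theorem 3). -/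
/-- The SPACE objective of equation (9) specialized to the case where the
opponent distribution equals the real-data distribution. -/
noncomputable def spaceLossSelf {α : Type*} (μ : ℝ) (pdata q : α → ℝ) : ℝ :=
  -∑' y, pdata y * (Real.log (q y / (q y + μ * pdata y))
        + μ * Real.log (pdata y / (pdata y + μ⁻¹ * q y)))

/-- The summand of the objective, for fixed `d`, is strictly largest at `q = d`, by strict
concavity of the logarithm. -/
theorem log_ratio_add_lt_of_ne {μ d q : ℝ} (hμ : 0 < μ) (hd : 0 < d) (hq : 0 < q) (hne : q ≠ d) :
    Real.log (q / (q + μ * d)) + μ * Real.log (d / (d + μ⁻¹ * q))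
      < Real.log (d / (d + μ * d)) + μ * Real.log (d / (d + μ⁻¹ * d)) := by
  have jensen : 1 / (1 + μ) * Real.log q + μ / (1 + μ) * Real.log d
      < Real.log (1 / (1 + μ) * q + μ / (1 + μ) * d) :=
    strictConcaveOn_log_Ioi.2 (Set.mem_Ioi.2 hq) (Set.mem_Ioi.2 hd) hne
      (by positivity) (by positivity) (by field_simp)
  have mix : 1 / (1 + μ) * q + μ / (1 + μ) * d = (q + μ * d) / (1 + μ) := by ring
  rw [mix, Real.log_div (by positivity) (by positivity)] at jensen
  have scaled := mul_lt_mul_of_pos_left jensen (show 0 < 1 + μ by positivity)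
  have clear_denom : (1 + μ) * (1 / (1 + μ) * Real.log q + μ / (1 + μ) * Real.log d)
      = Real.log q + μ * Real.log d := by field_simp
  rw [clear_denom] at scaled
  have expand : ∀ x, 0 < x → Real.log (x / (x + μ * d)) + μ * Real.log (d / (d + μ⁻¹ * x))
      = Real.log x - Real.log (x + μ * d)
        + μ * (Real.log d + Real.log μ - Real.log (x + μ * d)) := by
    intro x hx
    have hfrac : d / (d + μ⁻¹ * x) = d * μ / (x + μ * d) := by
      field_simp
      ring
    rw [hfrac, Real.log_div (by positivity) (by positivity),
      Real.log_div (by positivity) (by positivity), Real.log_mul (by positivity) (by positivity)]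
  have hdd : Real.log (d + μ * d) = Real.log (1 + μ) + Real.log d := by
    rw [← Real.log_mul (by positivity) (by positivity)]
    ring_nf
  rw [expand q hq, expand d hd, hdd]
  linarith

/-- Theorem 3 (maintainability): if the opponent distribution already equals
`pdata`, then `pdata` remains the unique minimizer of the SPACE objective. -/
theorem space_maintainability {α : Type*} [Countable α] (μ : ℝ) (hμ : 0 < μ)
    (pdata p : α → ℝ)
    (hd_pos : ∀ y, 0 < pdata y) (hp_pos : ∀ y, 0 < p y)
    (hd_sum : ∑' y, pdata y = 1) (hp_sum : ∑' y, p y = 1)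
    (hsum_p : Summable fun y => pdata y * (Real.log (p y / (p y + μ * pdata y))
        + μ * Real.log (pdata y / (pdata y + μ⁻¹ * p y))))
    (hsum_d : Summable fun y => pdata y * (Real.log (pdata y / (pdata y + μ * pdata y))
        + μ * Real.log (pdata y / (pdata y + μ⁻¹ * pdata y)))) :
    spaceLossSelf μ pdata p ≥ spaceLossSelf μ pdata pdata
    ∧ (spaceLossSelf μ pdata p = spaceLossSelf μ pdata pdata ↔ p = pdata) := by
  have term_lt : ∀ y, p y ≠ pdata y → _ := fun y hne =>
    mul_lt_mul_of_pos_left (log_ratio_add_lt_of_ne hμ (hd_pos y) (hp_pos y) hne) (hd_pos y)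
  have term_le : ∀ y, pdata y * (Real.log (p y / (p y + μ * pdata y))
        + μ * Real.log (pdata y / (pdata y + μ⁻¹ * p y)))
      ≤ pdata y * (Real.log (pdata y / (pdata y + μ * pdata y))
        + μ * Real.log (pdata y / (pdata y + μ⁻¹ * pdata y))) := by
    intro y
    by_cases h : p y = pdata y
    · rw [h]
    · exact (term_lt y h).le
  refine ⟨neg_le_neg (hsum_p.tsum_le_tsum term_le hsum_d), fun heq => ?_, fun h => by rw [h]⟩
  by_contra hne
  obtain ⟨y, hy⟩ := Function.ne_iff.1 hne
  exact (hsum_p.tsum_lt_tsum term_le (term_lt y hy) hsum_d).ne (neg_injective heq)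
end

section
/- Fix real numbers a ≥ 0, b > 0 and μ > 0, and define the per-response SPACE loss g : (0, ∞) → ℝ by g(s) = −[ a·log( s / (s + μ·b) ) + μ·b·log( μ·b / (s + μ·b) ) ]. Then for every s > 0, g has derivative at s equal to −( μ·b / (s + μ·b) )·( (a − s)/s ), and moreover μ·b/(s + μ·b) = σ_{μ⁻¹}( −(log s − log b) ) where σ_{μ⁻¹}(x) = (1 + μ⁻¹·exp(−x))⁻¹. That is, the derivative of the SPACE loss with respect to the model probability of a response equals −σ_{μ⁻¹}(−r)·(p_data − p_θ)·(d/ds log s) with r = log s − log b, as asserted in Theorem 1. -/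
/-- Theorem 1, pointwise form: the per-response SPACE loss
`g(s) = −[a·log(s/(s+μ·b)) + μ·b·log(μ·b/(s+μ·b))]` has derivative
`−(μ·b/(s+μ·b))·((a−s)/s)` at every `s > 0`, and the prefactor satisfies
`μ·b/(s+μ·b) = σ_{μ⁻¹}(−(log s − log b))` where
`σ_{μ⁻¹}(x) = (1+μ⁻¹·exp(−x))⁻¹`. -/
theorem space_loss_deriv (a b μ : ℝ) (ha : 0 ≤ a) (hb : 0 < b) (hμ : 0 < μ)
    (s : ℝ) (hs : 0 < s) :
    HasDerivAt
      (fun s : ℝ => -(a * Real.log (s / (s + μ * b)) + μ * b * Real.log (μ * b / (s + μ * b))))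
      (-(μ * b / (s + μ * b)) * ((a - s) / s)) s
    ∧ μ * b / (s + μ * b) = (1 + μ⁻¹ * Real.exp (-(-(Real.log s - Real.log b))))⁻¹ := by
  have hc : 0 < μ * b := mul_pos hμ hb
  have hsum : 0 < s + μ * b := add_pos hs hc
  constructor
  · have hden : HasDerivAt (fun s : ℝ => s + μ * b) 1 s := (hasDerivAt_id' s).add_const _
    have hfst := (((hasDerivAt_id' s).fun_div hden hsum.ne').log
      (div_pos hs hsum).ne').const_mul a
    have hsnd := (((hasDerivAt_const s (μ * b)).fun_div hden hsum.ne').log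
      (div_pos hc hsum).ne').const_mul (μ * b)
    refine (hfst.fun_add hsnd).fun_neg.congr_deriv ?_
    field_simp
    ring
  · rw [neg_neg, Real.exp_sub, Real.exp_log hs, Real.exp_log hb]
    field_simp
    ring
end

section
/- Fix real numbers a ≥ 0, b > 0 and μ > 0, and define g : (0, ∞) → ℝ by g(s) = −[ a·log( s / (s + μ·b) ) + μ·b·log( μ·b / (s + μ·b) ) ]. Then for every s > 0: if s < a then the derivative of g at s is strictly negative; if s > a then the derivative of g at s is strictly positive; and if s = a then the derivative of g at s is zero. Hence minimizing the SPACE loss increases the model probability of responses whose real-data probability exceeds their current model probability and decreases it otherwise (the response-dependent property). -/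
/-- The per-response SPACE loss. -/
noncomputable def gSpace (a b μ : ℝ) : ℝ → ℝ :=
  fun s => -(a * Real.log (s / (s + μ * b)) + μ * b * Real.log (μ * b / (s + μ * b)))

/-- The derivative of `gSpace` at a positive point. -/
theorem hasDerivAt_gSpace (a : ℝ) {b μ s : ℝ} (hb : 0 < b) (hμ : 0 < μ) (hs : 0 < s) :
    HasDerivAt (gSpace a b μ) (μ * b * (s - a) / (s * (s + μ * b))) s := by
  have hc : 0 < μ * b := mul_pos hμ hb
  have hsc : s + μ * b ≠ 0 := (add_pos hs hc).ne'
  have hden : HasDerivAt (fun x : ℝ => x + μ * b) 1 s := (hasDerivAt_id s).add_const _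
  have hlog₁ := ((hasDerivAt_id s).fun_div hden hsc).log (div_ne_zero hs.ne' hsc)
  have hlog₂ := ((hasDerivAt_const s (μ * b)).fun_div hden hsc).log (div_ne_zero hc.ne' hsc)
  refine ((hlog₁.const_mul a).fun_add (hlog₂.const_mul (μ * b))).fun_neg.congr_deriv ?_
  simp only [id]
  field_simp
  ring

/-- Response-dependent property (remark after Theorem 1): for `s > 0`, the
derivative of the per-response SPACE loss is strictly negative when `s < a`,
strictly positive when `s > a`, and zero when `s = a`. -/
theorem gSpace_deriv_sign (a b μ : ℝ) (ha : 0 ≤ a) (hb : 0 < b) (hμ : 0 < μ)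
    (s : ℝ) (hs : 0 < s) :
    (s < a → deriv (gSpace a b μ) s < 0)
    ∧ (a < s → 0 < deriv (gSpace a b μ) s)
    ∧ (s = a → deriv (gSpace a b μ) s = 0) := by
  have hc : 0 < μ * b := mul_pos hμ hb
  have hden : 0 < s * (s + μ * b) := mul_pos hs (add_pos hs hc)
  rw [(hasDerivAt_gSpace a hb hμ hs).deriv]
  refine ⟨fun h => ?_, fun h => ?_, fun h => ?_⟩
  · exact div_neg_of_neg_of_pos (mul_neg_of_pos_of_neg hc (sub_neg.2 h)) hden
  · exact div_pos (mul_pos hc (sub_pos.2 h)) hden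
  · simp [h]
end
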